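/- Let ν ∈ (0,1), let M : (0,∞) → (0,∞) be slowly varying, and let w : ℕ₀ → (0,∞) satisfy w(n) M(n) n^{1−ν} → 1 as n → ∞. Fix δ̂ ∈ ℝ and set δ_N := δ̂ M(N) N^{−ν} for N ∈ ℕ. Then for every T > 0, sup_{t ∈ [0,T]} |Ψ_{δ_N}(Nt) − Ψ̂^{ν}_{δ̂}(t)| → 0 as N → ∞, where Ψ_δ is extended to real arguments by linear interpolation; moreover Ψ̂^{ν}_{δ̂}(t) is finite for every t ≥ 0. -/

import Mathlib

open MeasureTheory
open scoped ENNReal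

/-- Product of `w` over the successive gaps of a list, starting from `prev`. -/
noncomputable def gapProd (w : ℕ → ℝ) : ℕ → List ℕ → ℝ
  | _, [] => 1
  | prev, n :: rest => w (n - prev) * gapProd w n rest

/-- Discrete constrained partition function
`Ψ^c_δ(N) = 1 + Σ_{k=1}^{N-1} (e^δ-1)^k Σ_{0<n₁<⋯<n_k<N} (∏ w(nᵢ-nᵢ₋₁)) w(N-n_k)/w(N)`,
with `Ψ^c_δ(0) = Ψ^c_δ(1) = 1`. -/
noncomputable def PsiCons (w : ℕ → ℝ) (δ : ℝ) (N : ℕ) : ℝ :=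
  1 + ∑ k ∈ Finset.Icc 1 (N - 1), (Real.exp δ - 1) ^ k *
      ∑ s ∈ (Finset.Ioo 0 N).powersetCard k,
        gapProd w 0 (s.sort (· ≤ ·) ++ [N]) / w N

/-- Discrete free partition function
`Ψ_δ(N) = 1 + Σ_{k=1}^{N} (e^δ-1)^k Σ_{0<n₁<⋯<n_k≤N} ∏ w(nᵢ-nᵢ₋₁)`, with `Ψ_δ(0) = 1`. -/
noncomputable def PsiFree (w : ℕ → ℝ) (δ : ℝ) (N : ℕ) : ℝ :=
  1 + ∑ k ∈ Finset.Icc 1 N, (Real.exp δ - 1) ^ k *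
      ∑ s ∈ (Finset.Icc 1 N).powersetCard k,
        gapProd w 0 (s.sort (· ≤ ·))

/-- Linear interpolation of `F : ℕ → ℝ` between consecutive integers. -/
noncomputable def interp (F : ℕ → ℝ) (x : ℝ) : ℝ :=
  F ⌊x⌋₊ + (x - ⌊x⌋₊) * (F (⌊x⌋₊ + 1) - F ⌊x⌋₊)

/-- The gap `vᵢ - vᵢ₋₁` (with `v₋₁ := 0`) of a vector `v : Fin k → ℝ`. -/
noncomputable def gapR {k : ℕ} (v : Fin k → ℝ) (i : Fin k) : ℝ :=
  v i - (if _h : (i : ℕ) = 0 then 0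
    else v ⟨(i : ℕ) - 1, lt_of_le_of_lt (Nat.sub_le _ _) i.isLt⟩)

/-- The `(k+1)`-fold simplex integral
`∫_{0<t₁<⋯<t_{k+1}<t} ∏ᵢ (tᵢ-tᵢ₋₁)^{-(1-ν)} dt₁⋯dt_{k+1}` (as a Lebesgue integral). -/
noncomputable def simplexIntLFree (ν t : ℝ) (k : ℕ) : ℝ≥0∞ :=
  ∫⁻ v : Fin (k + 1) → ℝ,
    Set.indicator {v : Fin (k + 1) → ℝ | StrictMono v ∧ 0 < v 0 ∧ v (Fin.last k) < t}
      (fun v => ENNReal.ofReal (∏ i, gapR v i ^ (-(1 - ν)))) v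

noncomputable def simplexIntFree (ν t : ℝ) (k : ℕ) : ℝ :=
  (simplexIntLFree ν t k).toReal

/-- The `(k+1)`-fold simplex integral
`∫_{0<t₁<⋯<t_{k+1}<t} t^{1-ν} (t-t_{k+1})^{-(1-ν)} ∏ᵢ (tᵢ-tᵢ₋₁)^{-(1-ν)} dt₁⋯dt_{k+1}`. -/
noncomputable def simplexIntLCons (ν t : ℝ) (k : ℕ) : ℝ≥0∞ :=
  ∫⁻ v : Fin (k + 1) → ℝ,
    Set.indicator {v : Fin (k + 1) → ℝ | StrictMono v ∧ 0 < v 0 ∧ v (Fin.last k) < t}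
      (fun v => ENNReal.ofReal (t ^ (1 - ν) * (t - v (Fin.last k)) ^ (-(1 - ν)) *
        ∏ i, gapR v i ^ (-(1 - ν)))) v

noncomputable def simplexIntCons (ν t : ℝ) (k : ℕ) : ℝ :=
  (simplexIntLCons ν t k).toReal

/-- Continuum free function `Ψ̂^ν_δ̂(t) = 1 + Σ_{k≥1} δ̂^k ∫_{0<t₁<⋯<t_k<t} ∏ (tᵢ-tᵢ₋₁)^{-(1-ν)}`. -/
noncomputable def PsiHatFree (ν d t : ℝ) : ℝ :=
  1 + ∑' k : ℕ, d ^ (k + 1) * simplexIntFree ν t k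

/-- Continuum constrained function `Ψ̂^{ν,c}_δ̂(t)`. -/
noncomputable def PsiHatCons (ν d t : ℝ) : ℝ :=
  1 + ∑' k : ℕ, d ^ (k + 1) * simplexIntCons ν t k

open Filter Topology

/-- The uniform convergence theorem for slowly varying functions, in additive form. -/
theorem eventually_forall_abs_sub_lt_of_tendsto_sub {h : ℝ → ℝ} (hm : Measurable h)
    (hs : ∀ s, Tendsto (fun u => h (u + s) - h u) atTop (𝓝 0)) {ε : ℝ} (hε : 0 < ε) :
    ∀ᶠ u in atTop, ∀ s ∈ Set.Icc (0 : ℝ) 1, |h (u + s) - h u| < ε := by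
  set ρ : ℝ → ℝ → ℝ := fun u z => min 1 |h (u + z) - h u| with hρ
  have hρm : ∀ u, Measurable (ρ u) := fun u =>
    measurable_const.min (((hm.comp (measurable_const_add u)).sub measurable_const).abs)
  have hρ0 : ∀ u z, 0 ≤ ρ u z := fun u z => le_min zero_le_one (abs_nonneg _)
  have hρb : ∀ u z, ‖ρ u z‖ ≤ 1 := fun u z => by
    rw [Real.norm_of_nonneg (hρ0 u z)]; exact min_le_left _ _
  have hint : ∀ u a b, IntervalIntegrable (ρ u) volume a b := fun u a b => by
    refine (intervalIntegrable_const (c := (1 : ℝ))).mono_fun (hρm u).aestronglyMeasurable ?_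
    exact Eventually.of_forall fun z => by simpa using hρb u z
  have hJ : Tendsto (fun u => ∫ z in (0 : ℝ)..2, ρ u z) atTop (𝓝 0) := by
    have := intervalIntegral.tendsto_integral_filter_of_dominated_convergence (μ := volume)
      (a := 0) (b := 2) (F := ρ) (f := fun _ => (0 : ℝ)) (l := atTop) (fun _ => (1 : ℝ))
      (Eventually.of_forall fun u => (hρm u).aestronglyMeasurable)
      (Eventually.of_forall fun u => Eventually.of_forall fun z _ => hρb u z)
      intervalIntegrable_const
      (Eventually.of_forall fun z _ => by
        have := (tendsto_const_nhds (x := (1 : ℝ))).min (hs z).abs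
        simpa using this)
    simpa using this
  have hsmall : (0 : ℝ) < min 1 ε / 2 := by positivity
  obtain ⟨U, hU⟩ := eventually_atTop.1 (hJ.eventually (gt_mem_nhds hsmall))
  refine eventually_atTop.2 ⟨U, fun u hu s ⟨hs0, hs1⟩ => ?_⟩
  have h1 : ∫ z in (0 : ℝ)..1, ρ (u + s) z ≤ ∫ z in (0 : ℝ)..2, ρ (u + s) z :=
    intervalIntegral.integral_mono_interval le_rfl (by norm_num) (by norm_num)
      (Eventually.of_forall fun z => hρ0 _ z) (hint _ _ _)
  have h2 : ∫ z in (0 : ℝ)..1, ρ u (s + z) ≤ ∫ z in (0 : ℝ)..2, ρ u z := by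
    rw [intervalIntegral.integral_comp_add_left (ρ u) s]
    exact intervalIntegral.integral_mono_interval (by linarith) (by linarith) (by linarith)
      (Eventually.of_forall fun z => hρ0 _ z) (hint _ _ _)
  have hint2 : IntervalIntegrable (fun z => ρ u (s + z)) volume 0 1 := by
    refine (intervalIntegrable_const (c := (1 : ℝ))).mono_fun
      ((hρm u).comp (measurable_const_add s)).aestronglyMeasurable ?_
    exact Eventually.of_forall fun z => by simpa using hρb u (s + z)
  have h3 : ρ u s ≤ (∫ z in (0 : ℝ)..1, ρ (u + s) z) + ∫ z in (0 : ℝ)..1, ρ u (s + z) := by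
    rw [← intervalIntegral.integral_add (hint _ _ _) hint2]
    calc ρ u s = ∫ _z in (0 : ℝ)..1, ρ u s := by simp
      _ ≤ _ := by
        refine intervalIntegral.integral_mono_on zero_le_one intervalIntegrable_const
          ((hint _ _ _).add hint2) fun z _ => ?_
        have htri : |h (u + s) - h u| ≤
            |h (u + s + z) - h (u + s)| + |h (u + (s + z)) - h u| := by
          rw [← add_assoc, abs_sub_comm (h (u + s + z)) (h (u + s))]
          exact abs_sub_le _ _ _
        simp only [hρ]
        have e1 := abs_nonneg (h (u + s + z) - h (u + s))
        have e2 := abs_nonneg (h (u + (s + z)) - h u)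
        rcases min_cases 1 |h (u + s) - h u| with h1 | h1 <;>
        rcases min_cases 1 |h (u + s + z) - h (u + s)| with h2 | h2 <;>
        rcases min_cases 1 |h (u + (s + z)) - h u| with h3 | h3 <;> linarith
  have h4 : ρ u s < min 1 ε := by
    linarith [hU u hu, hU (u + s) (by linarith)]
  rcases min_lt_iff.1 (lt_of_lt_of_le h4 le_rfl) with h5 | h5
  · exact absurd h5 (not_lt.2 (min_le_left _ _))
  · exact lt_of_lt_of_le h5 (min_le_right _ _)

theorem exists_forall_abs_sub_le_of_tendsto_sub {h : ℝ → ℝ} (hm : Measurable h)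
    (hs : ∀ s, Tendsto (fun u => h (u + s) - h u) atTop (𝓝 0)) {ε : ℝ} (hε : 0 < ε) :
    ∃ U, ∀ u v, U ≤ u → U ≤ v → |h u - h v| ≤ ε * (|u - v| + 1) := by
  obtain ⟨U, hU⟩ := eventually_atTop.1 (eventually_forall_abs_sub_lt_of_tendsto_sub hm hs hε)
  have key : ∀ (n : ℕ) (u s : ℝ), U ≤ u → 0 ≤ s → s ≤ n → |h (u + s) - h u| ≤ ε * n := by
    intro n
    induction n with
    | zero =>
      intro u s _ h0 h1
      have : s = 0 := le_antisymm (by simpa using h1) h0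
      simp [this]
    | succ n ih =>
      intro u s hu h0 h1
      push_cast at h1 ⊢
      rcases le_total s 1 with h2 | h2
      · have h3 := hU u hu s ⟨h0, h2⟩
        have : 0 ≤ ε * n := by positivity
        linarith
      · have h3 := hU u hu 1 ⟨zero_le_one, le_rfl⟩
        have h4 := ih (u + 1) (s - 1) (by linarith) (by linarith) (by linarith)
        have h5 : u + 1 + (s - 1) = u + s := by ring
        rw [h5] at h4
        linarith [abs_sub_le (h (u + s)) (h (u + 1)) (h u)]
  have key2 : ∀ u v, U ≤ v → v ≤ u → |h u - h v| ≤ ε * (|u - v| + 1) := by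
    intro u v hv huv
    have h1 := key ⌈u - v⌉₊ v (u - v) hv (by linarith) (Nat.le_ceil _)
    rw [add_sub_cancel] at h1
    refine h1.trans (mul_le_mul_of_nonneg_left ?_ hε.le)
    rw [abs_of_nonneg (by linarith)]
    exact (Nat.ceil_lt_add_one (by linarith)).le
  refine ⟨U, fun u v hu hv => ?_⟩
  rcases le_total v u with h1 | h1
  · exact key2 u v hv h1
  · rw [abs_sub_comm, abs_sub_comm u v]
    exact key2 v u hu h1

/-- Potter's bound for slowly varying functions. -/
theorem exists_forall_abs_log_sub_log_le {M : ℝ → ℝ} (hM_pos : ∀ x : ℝ, 0 < x → 0 < M x)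
    (hM_meas : Measurable M)
    (hM_slow : ∀ c : ℝ, 0 < c → Tendsto (fun x : ℝ => M (c * x) / M x) atTop (𝓝 1))
    {ε : ℝ} (hε : 0 < ε) :
    ∃ X, 0 < X ∧ ∀ x y, X ≤ x → X ≤ y →
      |Real.log (M x) - Real.log (M y)| ≤ ε * (|Real.log x - Real.log y| + 1) := by
  obtain ⟨U, hU⟩ := exists_forall_abs_sub_le_of_tendsto_sub
    (h := fun u => Real.log (M (Real.exp u)))
    (Real.measurable_log.comp (hM_meas.comp Real.measurable_exp)) (fun s => by
      have h1 := (hM_slow _ (Real.exp_pos s)).comp Real.tendsto_exp_atTop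
      have h2 := (Real.continuousAt_log one_ne_zero).tendsto.comp h1
      rw [Real.log_one] at h2
      refine h2.congr fun u => ?_
      simp only [Function.comp_apply]
      rw [Real.log_div (hM_pos _ (by positivity)).ne' (hM_pos _ (by positivity)).ne',
        ← Real.exp_add, add_comm s u]) hε
  refine ⟨Real.exp U, Real.exp_pos _, fun x y hx hy => ?_⟩
  have hx0 := (Real.exp_pos U).trans_le hx
  have hy0 := (Real.exp_pos U).trans_le hy
  have := hU (Real.log x) (Real.log y) ((Real.le_log_iff_exp_le hx0).2 hx)
    ((Real.le_log_iff_exp_le hy0).2 hy)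
  simpa only [Real.exp_log hx0, Real.exp_log hy0] using this

theorem mul_scale_mul_eq {ν a b c n N : ℝ} (hn : 0 < n) (hN : 0 < N) (ha : 0 < a) (hb : 0 < b) :
    N * (a / N ^ ν) * c =
      c * b * n ^ (1 - ν) * Real.exp (Real.log a - Real.log b) * (n / N) ^ (-(1 - ν)) := by
  rw [Real.exp_sub, Real.exp_log ha, Real.exp_log hb, Real.div_rpow hn.le hN.le,
    Real.rpow_neg hn.le, Real.rpow_neg hN.le, Real.rpow_sub hN, Real.rpow_one]
  have h1 := (Real.rpow_pos_of_pos hn (1 - ν)).ne'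
  have h2 := (Real.rpow_pos_of_pos hN ν).ne'
  field_simp

section Weights

variable {ν : ℝ} {M : ℝ → ℝ} {w : ℕ → ℝ}

theorem tendsto_scale_mul_weight (hM_pos : ∀ x : ℝ, 0 < x → 0 < M x) (hM_meas : Measurable M)
    (hM_slow : ∀ c : ℝ, 0 < c → Tendsto (fun x : ℝ => M (c * x) / M x) atTop (𝓝 1))
    (hw_asymp : Tendsto (fun n : ℕ => w n * M n * (n : ℝ) ^ (1 - ν)) atTop (𝓝 1))
    {ι : Type*} {l : Filter ι} {N n : ι → ℕ} (hN : Tendsto N l atTop) {x : ℝ} (hx : 0 < x)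
    (hn : Tendsto (fun i => (n i : ℝ) / N i) l (𝓝 x)) :
    Tendsto (fun i => (N i : ℝ) * (M (N i) / (N i : ℝ) ^ ν) * w (n i)) l
      (𝓝 (x ^ (-(1 - ν)))) := by
  have hNR : Tendsto (fun i => (N i : ℝ)) l atTop := tendsto_natCast_atTop_atTop.comp hN
  have hN1 : ∀ᶠ i in l, 0 < (N i : ℝ) := hNR.eventually_gt_atTop 0
  have hnR : Tendsto (fun i => (n i : ℝ)) l atTop := by
    refine (hn.pos_mul_atTop hx hNR).congr' ?_
    filter_upwards [hN1] with i hi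
    field_simp
  have hn1 : ∀ᶠ i in l, 0 < (n i : ℝ) := hnR.eventually_gt_atTop 0
  have hnN : Tendsto n l atTop := tendsto_natCast_atTop_iff.1 hnR
  have hlog : Tendsto (fun i => Real.log (M (N i)) - Real.log (M (n i))) l (𝓝 0) := by
    have hl := ((Real.continuousAt_log hx.ne').tendsto.comp hn).abs
    rw [Metric.tendsto_nhds]
    intro ε hε
    have hc : 0 < |Real.log x| + 2 := by positivity
    obtain ⟨X, -, hX⟩ := exists_forall_abs_log_sub_log_le hM_pos hM_meas hM_slow
      (ε := ε / (|Real.log x| + 2) / 2) (by positivity)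
    filter_upwards [hN1, hn1, hNR.eventually_ge_atTop X, hnR.eventually_ge_atTop X,
      hl.eventually (gt_mem_nhds (lt_add_one |Real.log x|))] with i h1 h2 h3 h4 h5
    rw [dist_zero_right, Real.norm_eq_abs]
    refine (hX _ _ h3 h4).trans_lt ?_
    simp only [Function.comp_apply] at h5
    rw [Real.log_div h2.ne' h1.ne', abs_sub_comm] at h5
    calc _ ≤ ε / (|Real.log x| + 2) / 2 * (|Real.log x| + 2) :=
        mul_le_mul_of_nonneg_left (by linarith) (by positivity)
      _ = ε / 2 := by field_simp
      _ < ε := by linarith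
  have hexp := (Real.continuous_exp.tendsto 0).comp hlog
  have hpow : Tendsto (fun i => ((n i : ℝ) / N i) ^ (-(1 - ν))) l (𝓝 (x ^ (-(1 - ν)))) :=
    hn.rpow_const (Or.inl hx.ne')
  have h := ((hw_asymp.comp hnN).mul hexp).mul hpow
  rw [Real.exp_zero, one_mul, one_mul] at h
  refine h.congr' ?_
  filter_upwards [hN1, hn1] with i h1 h2
  exact (mul_scale_mul_eq h2 h1 (hM_pos _ h1) (hM_pos _ h2)).symm

theorem exists_forall_le_mul_rpow_of_slowlyVarying (hM_pos : ∀ x : ℝ, 0 < x → 0 < M x)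
    (hM_meas : Measurable M)
    (hM_slow : ∀ c : ℝ, 0 < c → Tendsto (fun x : ℝ => M (c * x) / M x) atTop (𝓝 1))
    {ε : ℝ} (hε : 0 < ε) : ∃ C X, 0 ≤ C ∧ 1 ≤ X ∧ ∀ x, X ≤ x → M x ≤ C * x ^ ε := by
  obtain ⟨X, hX0, hX⟩ := exists_forall_abs_log_sub_log_le hM_pos hM_meas hM_slow hε
  set Y := max X 1
  have hY1 : 1 ≤ Y := le_max_right _ _
  have hY : 0 < M Y := hM_pos _ (by linarith)
  refine ⟨M Y * Real.exp ε, Y, by positivity, hY1, fun x hx => ?_⟩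
  have hx0 : 0 < x := by linarith
  have h1 := (abs_le.1 (hX x Y ((le_max_left _ _).trans hx) (le_max_left _ _))).2
  have h2 : |Real.log x - Real.log Y| ≤ Real.log x := by
    rw [abs_of_nonneg (sub_nonneg.2 (Real.log_le_log (by linarith) hx))]
    linarith [Real.log_nonneg hY1]
  have h3 : Real.log (M x) ≤ Real.log (M Y) + ε + Real.log x * ε := by
    nlinarith
  calc M x = Real.exp (Real.log (M x)) := (Real.exp_log (hM_pos _ hx0)).symm
    _ ≤ Real.exp (Real.log (M Y) + ε + Real.log x * ε) := Real.exp_le_exp.2 h3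
    _ = _ := by rw [Real.exp_add, Real.exp_add, Real.exp_log hY, Real.rpow_def_of_pos hx0]

theorem tendsto_scale_zero (hν : 0 < ν) (hM_pos : ∀ x : ℝ, 0 < x → 0 < M x)
    (hM_meas : Measurable M)
    (hM_slow : ∀ c : ℝ, 0 < c → Tendsto (fun x : ℝ => M (c * x) / M x) atTop (𝓝 1)) :
    Tendsto (fun N : ℕ => M N / (N : ℝ) ^ ν) atTop (𝓝 0) := by
  obtain ⟨C, X, -, hX1, hX⟩ := exists_forall_le_mul_rpow_of_slowlyVarying hM_pos hM_meas hM_slow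
    (half_pos hν)
  have h1 : Tendsto (fun x : ℝ => C * x ^ (-(ν / 2))) atTop (𝓝 0) := by
    simpa using (tendsto_rpow_neg_atTop (half_pos hν)).const_mul C
  have h2 : Tendsto (fun x : ℝ => M x / x ^ ν) atTop (𝓝 0) := by
    refine squeeze_zero' ?_ ?_ h1
    · filter_upwards [eventually_gt_atTop 0] with x hx
      have := hM_pos x hx
      positivity
    · filter_upwards [eventually_ge_atTop X] with x hx
      have hx0 : 0 < x := by linarith
      rw [div_le_iff₀ (by positivity), mul_assoc, ← Real.rpow_add hx0,
        show -(ν / 2) + ν = ν / 2 by ring]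
      exact hX x hx
  exact h2.comp tendsto_natCast_atTop_atTop

theorem abs_log_le_of_le {r K : ℝ} (hr : 0 < r) (hK : 1 ≤ K) (h : r ≤ K) :
    |Real.log r| ≤ 2 * Real.log K - Real.log r := by
  have h1 := Real.log_le_log hr h
  have h2 := Real.log_nonneg hK
  rcases abs_cases (Real.log r) with h3 | h3 <;> linarith

theorem exists_scale_mul_weight_le (hν : ν ∈ Set.Ioo (0 : ℝ) 1)
    (hM_pos : ∀ x : ℝ, 0 < x → 0 < M x) (hM_meas : Measurable M)
    (hM_slow : ∀ c : ℝ, 0 < c → Tendsto (fun x : ℝ => M (c * x) / M x) atTop (𝓝 1))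
    (hw_pos : ∀ n, 0 < w n)
    (hw_asymp : Tendsto (fun n : ℕ => w n * M n * (n : ℝ) ^ (1 - ν)) atTop (𝓝 1))
    {K : ℝ} (hK : 1 ≤ K) :
    ∃ C, 0 ≤ C ∧ ∀ᶠ N : ℕ in atTop, ∀ n : ℕ, 1 ≤ n → (n : ℝ) ≤ K * N →
      (N : ℝ) * (M N / (N : ℝ) ^ ν) * w n ≤ C * ((n : ℝ) / N) ^ (ν / 2 - 1) := by
  have hν0 := hν.1
  have hν2 : 0 < ν / 2 := half_pos hν0
  obtain ⟨X, hX0, hX⟩ := exists_forall_abs_log_sub_log_le hM_pos hM_meas hM_slow hν2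
  obtain ⟨C₁, Y, hC₁, hY1, hY⟩ :=
    exists_forall_le_mul_rpow_of_slowlyVarying hM_pos hM_meas hM_slow hν2
  obtain ⟨n₀, hn₀⟩ := eventually_atTop.1 (hw_asymp.eventually (gt_mem_nhds one_lt_two))
  obtain ⟨n₁, hn₁X⟩ := exists_nat_ge X
  set m := max n₀ n₁
  set W := ∑ n ∈ Finset.range m, w n
  have hW : ∀ n < m, w n ≤ W := fun n hn =>
    Finset.single_le_sum (fun i _ => (hw_pos i).le) (Finset.mem_range.2 hn)
  have hW0 : 0 ≤ W := Finset.sum_nonneg fun i _ => (hw_pos i).le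
  set A := 2 * Real.exp (ν / 2 * (2 * Real.log K + 1))
  set B := C₁ * W * (m : ℝ) ^ (1 - ν / 2)
  have hA : 0 ≤ A := by positivity
  have hB : 0 ≤ B := by positivity
  refine ⟨A + B, by positivity, ?_⟩
  filter_upwards [tendsto_natCast_atTop_atTop.eventually_ge_atTop X,
    tendsto_natCast_atTop_atTop.eventually_ge_atTop Y] with N hNX hNY n hn hnK
  have hN0 : (0 : ℝ) < N := by linarith
  have hn0 : (0 : ℝ) < n := by exact_mod_cast hn
  have hr : 0 < (n : ℝ) / N := by positivity
  have hrp : 0 < ((n : ℝ) / N) ^ (ν / 2 - 1) := Real.rpow_pos_of_pos hr _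
  rcases lt_or_ge n m with hnm | hnm
  · have h1 : (N : ℝ) * (M N / (N : ℝ) ^ ν) ≤ C₁ * (N : ℝ) ^ (1 - ν / 2) := by
      have h2 : (N : ℝ) * (M N / (N : ℝ) ^ ν) = M N * (N : ℝ) ^ (1 - ν) := by
        rw [Real.rpow_sub hN0, Real.rpow_one]; ring
      rw [h2]
      calc M N * (N : ℝ) ^ (1 - ν) ≤ C₁ * (N : ℝ) ^ (ν / 2) * (N : ℝ) ^ (1 - ν) := by
            gcongr; exact hY _ hNY
        _ = _ := by rw [mul_assoc, ← Real.rpow_add hN0]; congr 2; ring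
    have h3 : (N : ℝ) ^ (1 - ν / 2) = (n : ℝ) ^ (1 - ν / 2) * ((n : ℝ) / N) ^ (ν / 2 - 1) := by
      rw [← neg_sub 1 (ν / 2), Real.rpow_neg hr.le, Real.div_rpow hn0.le hN0.le]
      have := (Real.rpow_pos_of_pos hn0 (1 - ν / 2)).ne'
      field_simp
    have h4 : (n : ℝ) ^ (1 - ν / 2) ≤ (m : ℝ) ^ (1 - ν / 2) :=
      Real.rpow_le_rpow hn0.le (by exact_mod_cast hnm.le) (by linarith [hν.2])
    calc (N : ℝ) * (M N / (N : ℝ) ^ ν) * w n ≤ (C₁ * (N : ℝ) ^ (1 - ν / 2)) * W := by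
          gcongr
          · exact (hw_pos n).le
          · exact hW n hnm
      _ = C₁ * W * (n : ℝ) ^ (1 - ν / 2) * ((n : ℝ) / N) ^ (ν / 2 - 1) := by rw [h3]; ring
      _ ≤ B * ((n : ℝ) / N) ^ (ν / 2 - 1) :=
        mul_le_mul_of_nonneg_right (mul_le_mul_of_nonneg_left h4 (by positivity)) hrp.le
      _ ≤ _ := by gcongr; linarith
  · have hnX : X ≤ n := hn₁X.trans (by exact_mod_cast (le_max_right n₀ n₁).trans hnm)
    have h1 := (hn₀ n ((le_max_left _ _).trans hnm)).le
    have h2 := (abs_le.1 (hX N n hNX hnX)).2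
    rw [abs_sub_comm, ← Real.log_div hn0.ne' hN0.ne'] at h2
    have h3 := abs_log_le_of_le hr hK ((div_le_iff₀ hN0).2 hnK)
    have h4 : Real.log (M N) - Real.log (M n) ≤
        ν / 2 * (2 * Real.log K + 1) + Real.log ((n : ℝ) / N) * (-(ν / 2)) := by nlinarith
    rw [mul_scale_mul_eq hn0 hN0 (hM_pos _ hN0) (hM_pos _ hn0)]
    calc _ ≤ 2 * Real.exp (ν / 2 * (2 * Real.log K + 1) +
            Real.log ((n : ℝ) / N) * (-(ν / 2))) * ((n : ℝ) / N) ^ (-(1 - ν)) := by gcongr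
      _ = A * ((n : ℝ) / N) ^ (ν / 2 - 1) := by
        rw [Real.exp_add, ← Real.rpow_def_of_pos hr, ← mul_assoc, mul_assoc,
          ← Real.rpow_add hr]
        congr 2; ring
      _ ≤ _ := by gcongr; linarith

end Weights

theorem measurableSet_simplex (k : ℕ) (t : ℝ) : MeasurableSet
    {v : Fin (k + 1) → ℝ | StrictMono v ∧ 0 < v 0 ∧ v (Fin.last k) < t} := by
  refine MeasurableSet.inter ?_ (MeasurableSet.inter ?_ ?_)
  · change MeasurableSet {v : Fin (k + 1) → ℝ | StrictMono v}
    simp only [Fin.strictMono_iff_lt_succ, Set.ofPred_forall]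
    exact MeasurableSet.iInter fun i =>
      measurableSet_lt (measurable_pi_apply _) (measurable_pi_apply _)
  · exact measurableSet_lt measurable_const (measurable_pi_apply _)
  · exact measurableSet_lt (measurable_pi_apply _) measurable_const

theorem measurable_gapR {k : ℕ} (i : Fin k) : Measurable fun v : Fin k → ℝ => gapR v i := by
  unfold gapR
  split_ifs <;> fun_prop

theorem measurable_simplex_integrand (ν t : ℝ) (k : ℕ) : Measurable
    (Set.indicator {v : Fin (k + 1) → ℝ | StrictMono v ∧ 0 < v 0 ∧ v (Fin.last k) < t}
      (fun v => ENNReal.ofReal (∏ i, gapR v i ^ (-(1 - ν))))) := by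
  refine Measurable.indicator ?_ (measurableSet_simplex k t)
  exact (Finset.measurable_prod _ fun i _ => (measurable_gapR i).pow_const _).ennreal_ofReal

theorem gapR_zero {k : ℕ} (v : Fin (k + 1) → ℝ) : gapR v 0 = v 0 := by
  simp [gapR]

theorem gapR_cons_add_succ {k : ℕ} (x : ℝ) (u : Fin (k + 1) → ℝ) (i : Fin (k + 1)) :
    gapR (Fin.cons x ((fun _ => x) + u) : Fin (k + 2) → ℝ) i.succ = gapR u i := by
  refine Fin.cases ?_ (fun j => ?_) i
  · simp [gapR]
  · simp only [gapR, Fin.val_succ, Nat.add_eq_zero_iff, one_ne_zero, and_false, dite_false,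
      Nat.add_sub_cancel, Fin.cons_succ, Pi.add_apply]
    rw [show (⟨(j : ℕ) + 1, by lia⟩ : Fin (k + 2)) = Fin.succ ⟨j, by lia⟩ from rfl, Fin.cons_succ,
      Pi.add_apply]
    ring

theorem cons_add_mem_simplex_iff {k : ℕ} (x t : ℝ) (u : Fin (k + 1) → ℝ) :
    (Fin.cons x ((fun _ => x) + u) : Fin (k + 2) → ℝ) ∈
        {v : Fin (k + 2) → ℝ | StrictMono v ∧ 0 < v 0 ∧ v (Fin.last (k + 1)) < t} ↔
      0 < x ∧ u ∈ {v : Fin (k + 1) → ℝ | StrictMono v ∧ 0 < v 0 ∧ v (Fin.last k) < t - x} := by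
  simp only [Set.mem_ofPred_eq, Fin.strictMono_iff_lt_succ, Fin.cons_zero]
  rw [Fin.forall_fin_succ, ← Fin.succ_last]
  simp only [← Fin.succ_castSucc, Fin.cons_succ, Fin.castSucc_zero, Fin.cons_zero, Pi.add_apply,
    add_lt_add_iff_left, lt_add_iff_pos_right, lt_sub_iff_add_lt']
  tauto

theorem simplexIntLFree_zero (ν t : ℝ) :
    simplexIntLFree ν t 0 = ∫⁻ x in Set.Ioo 0 t, ENNReal.ofReal (x ^ (-(1 - ν))) := by
  refine (((volume_preserving_funUnique (Fin 1) ℝ).symm).lintegral_comp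
    (measurable_simplex_integrand ν t 0)).symm.trans ?_
  rw [← lintegral_indicator measurableSet_Ioo]
  refine lintegral_congr fun x => ?_
  have h1 : StrictMono ((MeasurableEquiv.funUnique (Fin 1) ℝ).symm x) :=
    Subsingleton.strictMono _
  have h2 : ∀ v : Fin (0 + 1) → ℝ, ∏ i, gapR v i ^ (-(1 - ν)) = v 0 ^ (-(1 - ν)) := fun v => by
    rw [Fin.prod_univ_succ]
    simp [gapR_zero]
  simp only [Set.indicator, Set.mem_ofPred_eq, h1, true_and, Set.mem_Ioo, Fin.last_zero, h2]
  rfl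

theorem simplexIntLFree_succ (ν t : ℝ) (k : ℕ) :
    simplexIntLFree ν t (k + 1) =
      ∫⁻ x in Set.Ioo 0 t, ENNReal.ofReal (x ^ (-(1 - ν))) * simplexIntLFree ν (t - x) k := by
  have hmp := (volume_preserving_piFinSuccAbove (fun _ : Fin (k + 2) => ℝ) 0).symm
  have hm := measurable_simplex_integrand ν t (k + 1)
  refine (hmp.lintegral_comp hm).symm.trans
    ((lintegral_prod _ (hm.comp hmp.measurable).aemeasurable).trans ?_)
  rw [← lintegral_indicator measurableSet_Ioo]
  refine lintegral_congr fun x => ?_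
  refine (lintegral_add_left_eq_self _ (fun _ => x)).symm.trans ?_
  have hcons : ∀ u : Fin (k + 1) → ℝ,
      (MeasurableEquiv.piFinSuccAbove (fun _ : Fin (k + 2) => ℝ) 0).symm (x, u) =
        Fin.cons x u := fun u => by
    simp [MeasurableEquiv.piFinSuccAbove, Fin.insertNthEquiv]
  simp only [Function.comp_apply, hcons]
  have hval : ∀ u : Fin (k + 1) → ℝ, 0 < x →
      Set.indicator {v : Fin (k + 2) → ℝ | StrictMono v ∧ 0 < v 0 ∧ v (Fin.last (k + 1)) < t}
        (fun v => ENNReal.ofReal (∏ i, gapR v i ^ (-(1 - ν))))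
          (Fin.cons x ((fun _ => x) + u)) =
      ENNReal.ofReal (x ^ (-(1 - ν))) *
        Set.indicator {v : Fin (k + 1) → ℝ | StrictMono v ∧ 0 < v 0 ∧ v (Fin.last k) < t - x}
        (fun v => ENNReal.ofReal (∏ i, gapR v i ^ (-(1 - ν)))) u := fun u hx => by
    simp only [Set.indicator, cons_add_mem_simplex_iff, hx, true_and, mul_ite, mul_zero]
    split_ifs
    · rw [Fin.prod_univ_succ, gapR_zero, Fin.cons_zero,
        ENNReal.ofReal_mul (Real.rpow_nonneg hx.le _)]
      simp only [gapR_cons_add_succ]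
    · rfl
  by_cases hx : x ∈ Set.Ioo 0 t
  · rw [Set.indicator_of_mem hx, simplexIntLFree, ← lintegral_const_mul' _ _ ENNReal.ofReal_ne_top]
    exact lintegral_congr fun u => hval u hx.1
  · rw [Set.indicator_of_notMem hx, lintegral_eq_zero_of_ae_eq_zero]
    refine Filter.Eventually.of_forall fun u => Set.indicator_of_notMem (fun h => hx ?_) _
    obtain ⟨h0, hu, hu0, hut⟩ := (cons_add_mem_simplex_iff x t u).1 h
    have := hu.monotone (Fin.zero_le (Fin.last k))
    exact ⟨h0, by linarith⟩

theorem monotone_simplexIntLFree (ν : ℝ) (k : ℕ) : Monotone fun t => simplexIntLFree ν t k := by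
  intro s t hst
  refine lintegral_mono fun v => Set.indicator_le_indicator_of_subset ?_ (fun _ => zero_le) v
  exact fun v hv => ⟨hv.1, hv.2.1, hv.2.2.trans_le hst⟩

theorem integrableOn_rpow_neg {ν : ℝ} (hν : 0 < ν) (t : ℝ) :
    IntegrableOn (fun x : ℝ => x ^ (ν - 1)) (Set.Ioc 0 t) := by
  rcases le_total 0 t with ht | ht
  · exact (intervalIntegrable_iff_integrableOn_Ioc_of_le ht).1
      (intervalIntegral.intervalIntegrable_rpow' (by linarith))
  · simp [Set.Ioc_eq_empty (not_lt.2 ht)]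

theorem simplexIntLFree_ne_top {ν : ℝ} (hν : 0 < ν) (k : ℕ) (t : ℝ) :
    simplexIntLFree ν t k ≠ ⊤ := by
  have h0 : ∀ t, simplexIntLFree ν t 0 ≠ ⊤ := fun t => by
    rw [simplexIntLFree_zero, neg_sub]
    exact ((integrableOn_rpow_neg hν t).mono_set Set.Ioo_subset_Ioc_self).lintegral_lt_top.ne
  induction k with
  | zero => exact h0 t
  | succ k ih =>
    refine ne_top_of_le_ne_top (ENNReal.mul_ne_top (h0 t) ih) ?_
    rw [simplexIntLFree_succ, simplexIntLFree_zero, ← lintegral_mul_const' _ _ ih]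
    refine setLIntegral_mono' measurableSet_Ioo fun x hx => ?_
    gcongr
    exact monotone_simplexIntLFree ν k (by linarith [hx.1])

/-- The `k`-fold simplex integral, for every `k ≥ 0`. -/
noncomputable def simplexIntOfNat (ν : ℝ) : ℕ → ℝ → ℝ
  | 0, _ => 1
  | k + 1, t => simplexIntFree ν t k

theorem simplexIntOfNat_succ {ν : ℝ} (hν : 0 < ν) (k : ℕ) (t : ℝ) :
    simplexIntOfNat ν (k + 1) t =
      ∫ x in Set.Ioo 0 t, x ^ (-(1 - ν)) * simplexIntOfNat ν k (t - x) := by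
  have hm : Measurable fun x : ℝ => ENNReal.ofReal (x ^ (-(1 - ν))) :=
    (measurable_id.pow_const _).ennreal_ofReal
  cases k with
  | zero =>
    simp only [simplexIntOfNat, simplexIntFree, simplexIntLFree_zero, mul_one]
    rw [← integral_toReal hm.aemeasurable (Filter.Eventually.of_forall fun _ =>
      ENNReal.ofReal_lt_top)]
    refine setIntegral_congr_fun measurableSet_Ioo fun x hx => ?_
    exact ENNReal.toReal_ofReal (Real.rpow_nonneg hx.1.le _)
  | succ k =>
    simp only [simplexIntOfNat, simplexIntFree, simplexIntLFree_succ]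
    rw [← integral_toReal]
    · refine setIntegral_congr_fun measurableSet_Ioo fun x hx => ?_
      simp only [ENNReal.toReal_mul]
      rw [ENNReal.toReal_ofReal (Real.rpow_nonneg hx.1.le _)]
    · exact (hm.mul ((monotone_simplexIntLFree ν k).measurable.comp
        (measurable_const.sub measurable_id))).aemeasurable
    · exact Filter.Eventually.of_forall fun x =>
        ENNReal.mul_lt_top ENNReal.ofReal_lt_top (simplexIntLFree_ne_top hν k _).lt_top

/-- The renewal sum `Σ_{0 < n₁ < ⋯ < n_k ≤ m} ∏ w(nᵢ - nᵢ₋₁)`, defined by conditioning on `n₁`. -/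
noncomputable def renewalSum (w : ℕ → ℝ) : ℕ → ℕ → ℝ
  | 0, _ => 1
  | k + 1, m => ∑ n ∈ Finset.Icc 1 m, w n * renewalSum w k (m - n)

theorem sum_powersetCard_succ_gapProd (w : ℕ → ℝ) (k p m : ℕ) :
    ∑ s ∈ (Finset.Icc (p + 1) m).powersetCard (k + 1), gapProd w p (s.sort (· ≤ ·)) =
      ∑ n ∈ Finset.Icc (p + 1) m, w (n - p) *
        ∑ s ∈ (Finset.Icc (n + 1) m).powersetCard k, gapProd w n (s.sort (· ≤ ·)) := by
  simp only [Finset.mul_sum]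
  rw [Finset.sum_sigma']
  symm
  have hlt : ∀ {n : ℕ} {s : Finset ℕ}, s ⊆ Finset.Icc (n + 1) m → ∀ b ∈ s, n < b :=
    fun h b hb => (Finset.mem_Icc.1 (h hb)).1
  refine Finset.sum_bij (fun x _ => insert x.1 x.2) ?_ ?_ ?_ ?_
  · rintro ⟨n, s⟩ h
    simp only [Finset.mem_sigma, Finset.mem_Icc, Finset.mem_powersetCard] at h ⊢
    obtain ⟨⟨h1, h2⟩, h3, h4⟩ := h
    refine ⟨Finset.insert_subset (Finset.mem_Icc.2 ⟨h1, h2⟩) (h3.trans ?_), ?_⟩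
    · exact Finset.Icc_subset_Icc_left (by lia)
    · rw [Finset.card_insert_of_notMem fun hn => lt_irrefl _ (hlt h3 n hn), h4]
  · rintro ⟨n, s⟩ h ⟨n', s'⟩ h' heq
    simp only [Finset.mem_sigma, Finset.mem_powersetCard] at h h' heq
    have hs := hlt h.2.1
    have hs' := hlt h'.2.1
    have hn : n = n' := by
      have h1 : n ∈ insert n' s' := heq ▸ Finset.mem_insert_self n s
      have h2 : n' ∈ insert n s := heq ▸ Finset.mem_insert_self n' s'
      rcases Finset.mem_insert.1 h1 with h1 | h1
      · exact h1
      rcases Finset.mem_insert.1 h2 with h2 | h2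
      · exact h2.symm
      exact absurd (hs' n h1) (hs n' h2).asymm
    subst hn
    have : s = s' := by
      rw [← Finset.erase_insert fun hn => lt_irrefl _ (hs n hn), heq,
        Finset.erase_insert fun hn => lt_irrefl _ (hs' n hn)]
    rw [this]
  · intro s hs
    obtain ⟨h1, h2⟩ := Finset.mem_powersetCard.1 hs
    have hne : s.Nonempty := Finset.card_pos.1 (by lia)
    refine ⟨⟨s.min' hne, s.erase (s.min' hne)⟩, ?_, Finset.insert_erase (s.min'_mem hne)⟩
    simp only [Finset.mem_sigma, Finset.mem_powersetCard]
    refine ⟨h1 (s.min'_mem hne), fun b hb => ?_, ?_⟩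
    · have h3 := Finset.min'_lt_of_mem_erase_min' s hne hb
      exact Finset.mem_Icc.2 ⟨h3, (Finset.mem_Icc.1 (h1 (Finset.mem_of_mem_erase hb))).2⟩
    · rw [Finset.card_erase_of_mem (s.min'_mem hne), h2, Nat.add_sub_cancel]
  · rintro ⟨n, s⟩ h
    simp only [Finset.mem_sigma, Finset.mem_powersetCard] at h
    have hs := hlt h.2.1
    rw [Finset.sort_insert _ (fun b hb => (hs b hb).le) fun hn => lt_irrefl _ (hs n hn), gapProd]

theorem sum_powersetCard_gapProd (w : ℕ → ℝ) (k p m : ℕ) :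
    ∑ s ∈ (Finset.Icc (p + 1) m).powersetCard k, gapProd w p (s.sort (· ≤ ·)) =
      renewalSum w k (m - p) := by
  induction k generalizing p with
  | zero => simp [gapProd, renewalSum]
  | succ k ih =>
    rw [sum_powersetCard_succ_gapProd, renewalSum]
    simp only [ih]
    refine Finset.sum_nbij' (· - p) (· + p) ?_ ?_ ?_ ?_ ?_
    all_goals simp only [Finset.mem_Icc]
    · intro n hn; lia
    · intro n hn; lia
    · intro n hn; lia
    · intro n hn; lia
    · intro n hn
      rw [show m - p - (n - p) = m - n by lia]

theorem renewalSum_eq_zero_of_lt (w : ℕ → ℝ) {k m : ℕ} (h : m < k) : renewalSum w k m = 0 := by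
  rw [← Nat.sub_zero m, ← sum_powersetCard_gapProd, Finset.powersetCard_eq_empty.2 (by simpa),
    Finset.sum_empty]

theorem renewalSum_nonneg {w : ℕ → ℝ} (hw : ∀ n, 0 ≤ w n) (k m : ℕ) : 0 ≤ renewalSum w k m := by
  induction k generalizing m with
  | zero => exact zero_le_one
  | succ k ih => exact Finset.sum_nonneg fun n _ => mul_nonneg (hw n) (ih _)

theorem psiFree_eq_tsum (w : ℕ → ℝ) (δ : ℝ) (m : ℕ) :
    PsiFree w δ m = ∑' k, (Real.exp δ - 1) ^ k * renewalSum w k m := by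
  rw [tsum_eq_sum (s := Finset.range (m + 1)), Finset.sum_range_succ', PsiFree, add_comm]
  · congr 1
    · refine Finset.sum_nbij' (· - 1) (· + 1) ?_ ?_ ?_ ?_ ?_
      all_goals simp only [Finset.mem_Icc, Finset.mem_range]
      · intro n hn; lia
      · intro n hn; lia
      · intro n hn; lia
      · intro n hn; lia
      · intro n hn
        have := sum_powersetCard_gapProd w n 0 m
        rw [zero_add, Nat.sub_zero] at this
        rw [this, Nat.sub_add_cancel hn.1]
    · simp [renewalSum]
  · intro k hk
    rw [renewalSum_eq_zero_of_lt w (by simpa using hk), mul_zero]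

theorem sum_Icc_eq_setIntegral_ceil {N : ℝ} (hN : 0 < N) (g : ℕ → ℝ) (m : ℕ) :
    ∑ n ∈ Finset.Icc 1 m, g n = ∫ x in Set.Ioc 0 (m / N), N * g ⌈N * x⌉₊ := by
  have hceil : ∀ k : ℕ, ∀ x ∈ Set.Ioc ((k : ℝ) / N) (((k + 1 : ℕ) : ℝ) / N),
      N * g ⌈N * x⌉₊ = N * g (k + 1) := fun k x hx => by
    rw [(Nat.ceil_eq_iff (Nat.succ_ne_zero k)).2 ⟨?_, ?_⟩]
    · rw [Nat.succ_sub_one, mul_comm]; exact (div_lt_iff₀ hN).1 hx.1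
    · rw [mul_comm]; exact (le_div_iff₀ hN).1 hx.2
  have hle : ∀ k : ℕ, (k : ℝ) / N ≤ ((k + 1 : ℕ) : ℝ) / N := fun k => by gcongr; simp
  have hcongr : ∀ k : ℕ, Set.EqOn (fun _ => N * g (k + 1)) (fun x => N * g ⌈N * x⌉₊)
      (Set.uIoc ((k : ℝ) / N) (((k + 1 : ℕ) : ℝ) / N)) := fun k x hx => by
    rw [Set.uIoc_of_le (hle k)] at hx
    exact (hceil k x hx).symm
  have h := intervalIntegral.sum_integral_adjacent_intervals (μ := volume)
    (f := fun x => N * g ⌈N * x⌉₊) (a := fun k : ℕ => (k : ℝ) / N) (n := m)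
    fun k _ => intervalIntegrable_const.congr (hcongr k)
  have hpiece : ∀ k : ℕ, ∫ x in ((k : ℝ) / N)..(((k + 1 : ℕ) : ℝ) / N), N * g ⌈N * x⌉₊ =
      g (k + 1) := fun k => by
    rw [intervalIntegral.integral_of_le (hle k),
      setIntegral_congr_fun measurableSet_Ioc (hceil k), ← intervalIntegral.integral_of_le (hle k),
      intervalIntegral.integral_const, smul_eq_mul]
    push_cast
    field_simp
    ring
  rw [← intervalIntegral.integral_of_le (by positivity)]
  simp only [hpiece, Nat.cast_zero, zero_div] at h
  rw [← h, Finset.range_eq_Ico, Finset.sum_Ico_add' g 0 m 1]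
  rfl

theorem sum_mul_exp_neg_le {w : ℕ → ℝ} (hw : ∀ n, 0 ≤ w n) {α a C r N : ℝ} (hα : 0 < α)
    (hα1 : α ≤ 1) (ha : 0 ≤ a) (hC : 0 ≤ C) (hr : 0 < r) (hN : 0 < N) {m : ℕ}
    (hb : ∀ n : ℕ, 1 ≤ n → n ≤ m → N * a * w n ≤ C * ((n : ℝ) / N) ^ (α - 1)) :
    ∑ n ∈ Finset.Icc 1 m, a * w n * Real.exp (-(r * (n / N))) ≤
      C * ((1 / r) ^ α * Real.Gamma α) := by
  have hint : IntegrableOn (fun t : ℝ => t ^ (α - 1) * Real.exp (-(r * t))) (Set.Ioi 0) := by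
    by_contra h
    have h1 := Real.integral_rpow_mul_exp_neg_mul_Ioi hα hr
    rw [integral_undef h] at h1
    have h2 := Real.Gamma_pos_of_pos hα
    have : 0 < (1 / r) ^ α * Real.Gamma α := by positivity
    exact this.ne h1
  rw [← Real.integral_rpow_mul_exp_neg_mul_Ioi hα hr, ← integral_const_mul,
    sum_Icc_eq_setIntegral_ceil hN (fun n : ℕ => a * w n * Real.exp (-(r * (n / N)))),
    ← integral_indicator measurableSet_Ioc, ← integral_indicator measurableSet_Ioi]
  refine integral_mono_of_nonneg (Eventually.of_forall fun x => ?_)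
    ((integrable_indicator_iff measurableSet_Ioi).2 (hint.const_mul C))
    (Eventually.of_forall fun x => ?_)
  · refine Set.indicator_nonneg (fun y _ => ?_) x
    have := hw ⌈N * y⌉₊
    positivity
  · by_cases hx : x ∈ Set.Ioc 0 ((m : ℝ) / N)
    · rw [Set.indicator_of_mem hx, Set.indicator_of_mem (Set.mem_Ioi.2 hx.1)]
      have hx0 := hx.1
      have h1 : 1 ≤ ⌈N * x⌉₊ := Nat.one_le_ceil_iff.2 (by positivity)
      have h2 : ⌈N * x⌉₊ ≤ m := Nat.ceil_le.2 (by
        rw [mul_comm]; exact (le_div_iff₀ hN).1 hx.2)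
      have h3 : x ≤ (⌈N * x⌉₊ : ℝ) / N := by
        rw [le_div_iff₀ hN, mul_comm]; exact Nat.le_ceil _
      have h4 : ((⌈N * x⌉₊ : ℝ) / N) ^ (α - 1) ≤ x ^ (α - 1) :=
        Real.rpow_le_rpow_of_nonpos hx0 h3 (by linarith)
      calc N * (a * w ⌈N * x⌉₊ * Real.exp (-(r * (⌈N * x⌉₊ / N))))
          = N * a * w ⌈N * x⌉₊ * Real.exp (-(r * (⌈N * x⌉₊ / N))) := by ring
        _ ≤ C * x ^ (α - 1) * Real.exp (-(r * x)) := by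
          refine mul_le_mul ((hb _ h1 h2).trans (mul_le_mul_of_nonneg_left h4 hC))
            (Real.exp_le_exp.2 (neg_le_neg (mul_le_mul_of_nonneg_left h3 hr.le)))
            (Real.exp_nonneg _) (by positivity)
        _ = _ := by ring
    · rw [Set.indicator_of_notMem hx]
      refine Set.indicator_nonneg (fun y hy => ?_) x
      have : 0 < y := hy
      positivity

theorem pow_mul_renewalSum_le {w : ℕ → ℝ} (hw : ∀ n, 0 ≤ w n) {α a C r N : ℝ} (hα : 0 < α)
    (hα1 : α ≤ 1) (ha : 0 ≤ a) (hC : 0 ≤ C) (hr : 0 < r) (hN : 0 < N) (k : ℕ) {m : ℕ}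
    (hb : ∀ n : ℕ, 1 ≤ n → n ≤ m → N * a * w n ≤ C * ((n : ℝ) / N) ^ (α - 1)) :
    a ^ k * renewalSum w k m ≤
      Real.exp (r * (m / N)) * (C * ((1 / r) ^ α * Real.Gamma α)) ^ k := by
  set q := C * ((1 / r) ^ α * Real.Gamma α)
  have hΓ := (Real.Gamma_pos_of_pos hα).le
  have hq : 0 ≤ q := by positivity
  induction k generalizing m with
  | zero => simpa [renewalSum] using (by positivity : 0 ≤ r * (m / N))
  | succ k ih =>
    calc a ^ (k + 1) * renewalSum w (k + 1) m
        = ∑ n ∈ Finset.Icc 1 m, a * w n * (a ^ k * renewalSum w k (m - n)) := by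
          rw [renewalSum, Finset.mul_sum]
          exact Finset.sum_congr rfl fun n _ => by ring
      _ ≤ ∑ n ∈ Finset.Icc 1 m,
            a * w n * (Real.exp (r * (((m - n : ℕ) : ℝ) / N)) * q ^ k) := by
          refine Finset.sum_le_sum fun n hn => ?_
          refine mul_le_mul_of_nonneg_left (ih fun j hj hjm => hb j hj (by lia)) ?_
          exact mul_nonneg ha (hw n)
      _ = Real.exp (r * (m / N)) * q ^ k *
            ∑ n ∈ Finset.Icc 1 m, a * w n * Real.exp (-(r * (n / N))) := by
          rw [Finset.mul_sum]
          refine Finset.sum_congr rfl fun n hn => ?_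
          rw [Nat.cast_sub (Finset.mem_Icc.1 hn).2,
            show r * (((m : ℝ) - n) / N) = r * (m / N) + -(r * (n / N)) by ring, Real.exp_add]
          ring
      _ ≤ Real.exp (r * (m / N)) * q ^ k * q := by
          gcongr
          exact sum_mul_exp_neg_le hw hα hα1 ha hC hr hN hb
      _ = _ := by ring

theorem tendsto_natFloor_div {ι : Type*} {l : Filter ι} {N : ι → ℕ} {s : ι → ℝ} {t : ℝ}
    (hN : Tendsto N l atTop) (hs0 : ∀ᶠ i in l, 0 ≤ s i) (hs : Tendsto s l (𝓝 t)) :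
    Tendsto (fun i => (⌊(N i : ℝ) * s i⌋₊ : ℝ) / N i) l (𝓝 t) := by
  have hNR : Tendsto (fun i => (N i : ℝ)) l atTop := tendsto_natCast_atTop_atTop.comp hN
  have hinv : Tendsto (fun i => s i - (N i : ℝ)⁻¹) l (𝓝 t) := by
    simpa using hs.sub (tendsto_inv_atTop_zero.comp hNR)
  refine tendsto_of_tendsto_of_tendsto_of_le_of_le' hinv hs ?_ ?_
  · filter_upwards [hNR.eventually_gt_atTop 0] with i h0
    rw [le_div_iff₀ h0, sub_mul, inv_mul_cancel₀ h0.ne']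
    linarith [Nat.lt_floor_add_one ((N i : ℝ) * s i)]
  · filter_upwards [hNR.eventually_gt_atTop 0, hs0] with i h0 h1
    rw [div_le_iff₀ h0, mul_comm]
    exact Nat.floor_le (by positivity)

section Limit

variable {w : ℕ → ℝ} {a : ℕ → ℝ} {α ν : ℝ}

theorem exists_pow_mul_renewalSum_le (hw : ∀ n, 0 ≤ w n) (ha : ∀ N, 0 ≤ a N) (hα : 0 < α)
    (hα1 : α ≤ 1) {C K : ℝ} (hC : 0 ≤ C)
    (hdom : ∀ᶠ N : ℕ in atTop, ∀ n : ℕ, 1 ≤ n → (n : ℝ) ≤ K * N →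
      (N : ℝ) * a N * w n ≤ C * ((n : ℝ) / N) ^ (α - 1)) {D : ℝ} (hD : 0 ≤ D) :
    ∃ B, 0 ≤ B ∧ ∀ᶠ N : ℕ in atTop, ∀ k m : ℕ, (m : ℝ) ≤ K * N →
      D ^ k * (a N ^ k * renewalSum w k m) ≤ B * (1 / 2) ^ k := by
  have hlim : Tendsto (fun r : ℝ => D * (C * ((1 / r) ^ α * Real.Gamma α))) atTop (𝓝 0) := by
    have h1 : Tendsto (fun r : ℝ => (1 / r) ^ α) atTop (𝓝 0) := by
      have := (tendsto_inv_atTop_zero (𝕜 := ℝ)).rpow_const (p := α) (Or.inr hα.le)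
      rw [Real.zero_rpow hα.ne'] at this
      simpa only [one_div] using this
    simpa using ((h1.mul_const (Real.Gamma α)).const_mul C).const_mul D
  obtain ⟨r, hr2, hr⟩ := ((hlim.eventually (gt_mem_nhds (by norm_num : (0 : ℝ) < 1 / 2))).and
    (eventually_gt_atTop 0)).exists
  have hΓ := (Real.Gamma_pos_of_pos hα).le
  refine ⟨Real.exp (r * K), by positivity, ?_⟩
  filter_upwards [hdom, eventually_gt_atTop 0] with N hN hN0 k m hm
  have hNR : (0 : ℝ) < N := by exact_mod_cast hN0
  have h := pow_mul_renewalSum_le hw hα hα1 (ha N) hC hr hNR k (m := m) fun n hn hnm =>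
    hN n hn ((by exact_mod_cast hnm : (n : ℝ) ≤ m).trans hm)
  calc D ^ k * (a N ^ k * renewalSum w k m)
      ≤ D ^ k * (Real.exp (r * (m / N)) * (C * ((1 / r) ^ α * Real.Gamma α)) ^ k) := by gcongr
    _ = Real.exp (r * (m / N)) * (D * (C * ((1 / r) ^ α * Real.Gamma α))) ^ k := by
      rw [mul_pow D]; ring
    _ ≤ _ := by
      gcongr
      rwa [div_le_iff₀ hNR]

theorem tendsto_pow_mul_renewalSum (hν : 0 < ν) (hw : ∀ n, 0 ≤ w n) (ha : ∀ N, 0 ≤ a N)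
    (hα : 0 < α) (hα1 : α ≤ 1)
    (hdom : ∀ K : ℝ, 1 ≤ K → ∃ C, 0 ≤ C ∧ ∀ᶠ N : ℕ in atTop, ∀ n : ℕ, 1 ≤ n → (n : ℝ) ≤ K * N →
      (N : ℝ) * a N * w n ≤ C * ((n : ℝ) / N) ^ (α - 1))
    {ι : Type*} {l : Filter ι} [l.IsCountablyGenerated] {N : ι → ℕ} (hN : Tendsto N l atTop)
    (hlim : ∀ (n : ι → ℕ) (x : ℝ), 0 < x → Tendsto (fun i => (n i : ℝ) / N i) l (𝓝 x) →
      Tendsto (fun i => (N i : ℝ) * a (N i) * w (n i)) l (𝓝 (x ^ (-(1 - ν)))))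
    (k : ℕ) {m : ι → ℕ} {t : ℝ} (ht : 0 ≤ t)
    (hm : Tendsto (fun i => (m i : ℝ) / N i) l (𝓝 t)) :
    Tendsto (fun i => a (N i) ^ k * renewalSum w k (m i)) l (𝓝 (simplexIntOfNat ν k t)) := by
  induction k generalizing m t with
  | zero => simpa [renewalSum, simplexIntOfNat] using tendsto_const_nhds
  | succ k ih =>
    have hNR : Tendsto (fun i => (N i : ℝ)) l atTop := tendsto_natCast_atTop_atTop.comp hN
    have hN0 : ∀ᶠ i in l, 0 < (N i : ℝ) := hNR.eventually_gt_atTop 0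
    obtain ⟨C, hC, hCN⟩ := hdom (t + 1) (by linarith)
    obtain ⟨B, hB, hBN⟩ := exists_pow_mul_renewalSum_le hw ha hα hα1 hC hCN zero_le_one
    have hmt : ∀ᶠ i in l, (m i : ℝ) / N i < t + 1 := hm.eventually (gt_mem_nhds (by linarith))
    rw [simplexIntOfNat_succ hν, ← integral_indicator measurableSet_Ioo]
    set f : ι → ℝ → ℝ := fun i => Set.indicator (Set.Ioc 0 ((m i : ℝ) / N i)) fun x =>
      (N i : ℝ) * (a (N i) * w ⌈N i * x⌉₊ * (a (N i) ^ k * renewalSum w k (m i - ⌈N i * x⌉₊)))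
    have hf : (fun i => a (N i) ^ (k + 1) * renewalSum w (k + 1) (m i)) =ᶠ[l]
        fun i => ∫ x, f i x := by
      filter_upwards [hN0] with i hi
      rw [integral_indicator measurableSet_Ioc, ← sum_Icc_eq_setIntegral_ceil hi (fun n : ℕ =>
        a (N i) * w n * (a (N i) ^ k * renewalSum w k (m i - n))), renewalSum, Finset.mul_sum]
      exact Finset.sum_congr rfl fun n _ => by ring
    refine Tendsto.congr' hf.symm ?_
    refine tendsto_integral_filter_of_dominated_convergence
      (Set.indicator (Set.Ioc 0 (t + 1)) fun x => C * B * x ^ (α - 1)) ?_ ?_ ?_ ?_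
    · refine Eventually.of_forall fun i => ?_
      have h1 : Measurable fun x : ℝ => ⌈(N i : ℝ) * x⌉₊ :=
        Nat.measurable_ceil.comp (measurable_const_mul _)
      have h2 : Measurable fun n : ℕ => (N i : ℝ) *
        (a (N i) * w n * (a (N i) ^ k * renewalSum w k (m i - n))) := measurable_from_nat
      exact ((h2.comp h1).indicator measurableSet_Ioc).aestronglyMeasurable
    · filter_upwards [hN0, hmt, hN.eventually hCN, hN.eventually hBN] with i h0 h1 h2 h3
      refine Eventually.of_forall fun x => ?_
      by_cases hx : x ∈ Set.Ioc 0 ((m i : ℝ) / N i)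
      · have hx0 := hx.1
        have hmK : (m i : ℝ) ≤ (t + 1) * N i := ((div_lt_iff₀ h0).1 h1).le
        have e1 : 1 ≤ ⌈(N i : ℝ) * x⌉₊ := Nat.one_le_ceil_iff.2 (by positivity)
        have e2 : ⌈(N i : ℝ) * x⌉₊ ≤ m i := Nat.ceil_le.2 (by
          rw [mul_comm]; exact (le_div_iff₀ h0).1 hx.2)
        have e3 : x ≤ (⌈(N i : ℝ) * x⌉₊ : ℝ) / N i := by
          rw [le_div_iff₀ h0, mul_comm]; exact Nat.le_ceil _
        have e4 : ((⌈(N i : ℝ) * x⌉₊ : ℝ) / N i) ^ (α - 1) ≤ x ^ (α - 1) :=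
          Real.rpow_le_rpow_of_nonpos hx0 e3 (by linarith)
        have e5 := h2 _ e1 ((by exact_mod_cast e2 :
          (⌈(N i : ℝ) * x⌉₊ : ℝ) ≤ m i).trans hmK)
        have e6 := h3 k (m i - ⌈(N i : ℝ) * x⌉₊) (le_trans (by exact_mod_cast Nat.sub_le _ _) hmK)
        have e7 : B * (1 / 2) ^ k ≤ B :=
          mul_le_of_le_one_right hB (pow_le_one₀ (by norm_num) (by norm_num))
        rw [one_pow, one_mul] at e6
        have e8 : 0 ≤ a (N i) ^ k * renewalSum w k (m i - ⌈(N i : ℝ) * x⌉₊) :=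
          mul_nonneg (pow_nonneg (ha _) _) (renewalSum_nonneg hw _ _)
        have e9 : 0 ≤ (N i : ℝ) * a (N i) * w ⌈(N i : ℝ) * x⌉₊ :=
          mul_nonneg (mul_nonneg h0.le (ha _)) (hw _)
        simp only [f]
        rw [Set.indicator_of_mem hx, Set.indicator_of_mem (show x ∈ Set.Ioc 0 (t + 1) from
          ⟨hx0, hx.2.trans h1.le⟩), ← mul_assoc (N i : ℝ), ← mul_assoc (N i : ℝ),
          Real.norm_of_nonneg (mul_nonneg e9 e8)]
        calc _ ≤ (C * x ^ (α - 1)) * B := by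
              refine mul_le_mul (e5.trans (mul_le_mul_of_nonneg_left e4 hC)) (e6.trans e7) e8
                (by positivity)
          _ = _ := by ring
      · simp only [f]
        rw [Set.indicator_of_notMem hx, norm_zero]
        refine Set.indicator_nonneg (fun y hy => ?_) x
        have : 0 < y := hy.1
        positivity
    · exact (integrable_indicator_iff measurableSet_Ioc).2
        ((integrableOn_rpow_neg hα _).const_mul _)
    · filter_upwards [Measure.ae_ne volume t] with x hxt
      rcases le_or_gt x 0 with hx0 | hx0
      · have h1 : ∀ i, f i x = 0 := fun i =>
          Set.indicator_of_notMem (fun h => absurd h.1 (not_lt.2 hx0)) _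
        rw [Set.indicator_of_notMem fun h => absurd h.1 (not_lt.2 hx0)]
        simp only [h1]
        exact tendsto_const_nhds
      rcases lt_or_gt_of_ne hxt with hlt | hgt
      · rw [Set.indicator_of_mem (show x ∈ Set.Ioo 0 t from ⟨hx0, hlt⟩)]
        have hc : Tendsto (fun i => (⌈(N i : ℝ) * x⌉₊ : ℝ) / N i) l (𝓝 x) := by
          simpa only [mul_comm, Function.comp_def] using
            (tendsto_nat_ceil_mul_div_atTop hx0.le).comp hNR
        have hmx : ∀ᶠ i in l, x < (m i : ℝ) / N i := hm.eventually (lt_mem_nhds hlt)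
        have hsub : Tendsto (fun i => ((m i - ⌈(N i : ℝ) * x⌉₊ : ℕ) : ℝ) / N i) l
            (𝓝 (t - x)) := by
          refine (hm.sub hc).congr' ?_
          filter_upwards [hN0, hmx] with i h0 h1
          rw [Nat.cast_sub (Nat.ceil_le.2 (by rw [mul_comm]; exact ((lt_div_iff₀ h0).1 h1).le)),
            sub_div]
        refine ((hlim _ x hx0 hc).mul (ih (by linarith) hsub)).congr' ?_
        filter_upwards [hmx] with i h1
        simp only [f]
        rw [Set.indicator_of_mem (show x ∈ Set.Ioc 0 ((m i : ℝ) / N i) from ⟨hx0, h1.le⟩)]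
        ring
      · rw [Set.indicator_of_notMem fun h => absurd h.2 (not_lt.2 hgt.le)]
        refine tendsto_const_nhds.congr' ?_
        filter_upwards [hm.eventually (gt_mem_nhds hgt)] with i h1
        exact (Set.indicator_of_notMem (fun h => absurd h.2 (not_le.2 h1)) _).symm

theorem simplexIntOfNat_nonneg (ν : ℝ) (k : ℕ) (t : ℝ) : 0 ≤ simplexIntOfNat ν k t := by
  cases k with
  | zero => exact zero_le_one
  | succ k => exact ENNReal.toReal_nonneg

theorem summable_pow_mul_simplexIntOfNat (hν : 0 < ν) (hw : ∀ n, 0 ≤ w n) (ha : ∀ N, 0 ≤ a N)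
    (hα : 0 < α) (hα1 : α ≤ 1)
    (hdom : ∀ K : ℝ, 1 ≤ K → ∃ C, 0 ≤ C ∧ ∀ᶠ N : ℕ in atTop, ∀ n : ℕ, 1 ≤ n → (n : ℝ) ≤ K * N →
      (N : ℝ) * a N * w n ≤ C * ((n : ℝ) / N) ^ (α - 1))
    (hlim : ∀ (n : ℕ → ℕ) (x : ℝ), 0 < x → Tendsto (fun i => (n i : ℝ) / i) atTop (𝓝 x) →
      Tendsto (fun i : ℕ => (i : ℝ) * a i * w (n i)) atTop (𝓝 (x ^ (-(1 - ν)))))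
    (d : ℝ) {t : ℝ} (ht : 0 ≤ t) : Summable fun k => d ^ k * simplexIntOfNat ν k t := by
  obtain ⟨C, hC, hCN⟩ := hdom (t + 1) (by linarith)
  obtain ⟨B, hB, hBN⟩ := exists_pow_mul_renewalSum_le hw ha hα hα1 hC hCN (abs_nonneg d)
  refine Summable.of_norm_bounded
    (summable_geometric_two.mul_left B) fun k => ?_
  rw [norm_mul, norm_pow, Real.norm_eq_abs, Real.norm_of_nonneg (simplexIntOfNat_nonneg ν k t)]
  refine le_of_tendsto ((tendsto_pow_mul_renewalSum (l := atTop) (N := fun i => i) hν hw ha hα hα1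
    hdom tendsto_id hlim k ht
    (tendsto_natFloor_div tendsto_id (.of_forall fun _ => ht) tendsto_const_nhds)).const_mul _) ?_
  filter_upwards [hBN] with N hN
  refine hN k _ ((Nat.floor_le (by positivity)).trans ?_)
  nlinarith [(Nat.cast_nonneg N : (0 : ℝ) ≤ N)]

theorem tendsto_psiFree (hν : 0 < ν) (hw : ∀ n, 0 ≤ w n) (ha : ∀ N, 0 ≤ a N)
    (ha0 : Tendsto a atTop (𝓝 0)) (hα : 0 < α) (hα1 : α ≤ 1)
    (hdom : ∀ K : ℝ, 1 ≤ K → ∃ C, 0 ≤ C ∧ ∀ᶠ N : ℕ in atTop, ∀ n : ℕ, 1 ≤ n → (n : ℝ) ≤ K * N →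
      (N : ℝ) * a N * w n ≤ C * ((n : ℝ) / N) ^ (α - 1))
    {ι : Type*} {l : Filter ι} [l.IsCountablyGenerated] {N : ι → ℕ} (hN : Tendsto N l atTop)
    (hlim : ∀ (n : ι → ℕ) (x : ℝ), 0 < x → Tendsto (fun i => (n i : ℝ) / N i) l (𝓝 x) →
      Tendsto (fun i => (N i : ℝ) * a (N i) * w (n i)) l (𝓝 (x ^ (-(1 - ν)))))
    (d : ℝ) {m : ι → ℕ} {t : ℝ} (ht : 0 ≤ t)
    (hm : Tendsto (fun i => (m i : ℝ) / N i) l (𝓝 t)) :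
    Tendsto (fun i => PsiFree w (d * a (N i)) (m i)) l
      (𝓝 (∑' k, d ^ k * simplexIntOfNat ν k t)) := by
  have hderiv : HasDerivAt (fun x => Real.exp (d * x)) d 0 := by
    simpa using ((hasDerivAt_id (0 : ℝ)).const_mul d).exp
  set φ := dslope (fun x => Real.exp (d * x)) 0
  have hφ : ∀ x, Real.exp (d * x) - 1 = φ x * x := fun x => by
    have := sub_smul_dslope (fun x => Real.exp (d * x)) 0 x
    simp only [mul_zero, Real.exp_zero, sub_zero, smul_eq_mul] at this
    rw [← this, mul_comm]
  have hφ0 : Tendsto φ (𝓝 0) (𝓝 d) := by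
    have := continuousAt_dslope_same.2 hderiv.differentiableAt
    rwa [ContinuousAt, dslope_same, hderiv.deriv] at this
  have hφN : Tendsto (fun i => φ (a (N i))) l (𝓝 d) := hφ0.comp (ha0.comp hN)
  obtain ⟨C, hC, hCN⟩ := hdom (t + 1) (by linarith)
  obtain ⟨B, hB, hBN⟩ := exists_pow_mul_renewalSum_le hw ha hα hα1 hC hCN
    (by positivity : 0 ≤ |d| + 1)
  simp only [psiFree_eq_tsum, hφ, mul_pow, mul_assoc]
  refine tendsto_tsum_of_dominated_convergence (bound := fun k : ℕ => B * (1 / 2 : ℝ) ^ k)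
    (summable_geometric_two.mul_left B) (fun k => ?_) ?_
  · exact (hφN.pow k).mul (tendsto_pow_mul_renewalSum hν hw ha hα hα1 hdom hN hlim k ht hm)
  · have hNR : Tendsto (fun i => (N i : ℝ)) l atTop := tendsto_natCast_atTop_atTop.comp hN
    filter_upwards [hφN.abs.eventually (gt_mem_nhds (lt_add_one |d|)), hN.eventually hBN,
      hNR.eventually_gt_atTop 0, hm.eventually (gt_mem_nhds (lt_add_one t))] with i h1 h2 h3 h4 k
    have h5 : 0 ≤ a (N i) ^ k * renewalSum w k (m i) :=
      mul_nonneg (pow_nonneg (ha _) _) (renewalSum_nonneg hw _ _)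
    rw [norm_mul, norm_pow, Real.norm_eq_abs, Real.norm_of_nonneg h5]
    refine le_trans ?_ (h2 k (m i) ((div_lt_iff₀ h3).1 h4).le)
    gcongr

end Limit

theorem tendsto_interp {ι : Type*} {l : Filter ι} {F : ι → ℕ → ℝ} {x : ι → ℝ} {L : ℝ}
    (hx : ∀ᶠ i in l, 0 ≤ x i) (h0 : Tendsto (fun i => F i ⌊x i⌋₊) l (𝓝 L))
    (h1 : Tendsto (fun i => F i (⌊x i⌋₊ + 1)) l (𝓝 L)) :
    Tendsto (fun i => interp (F i) (x i)) l (𝓝 L) := by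
  unfold interp
  have hd : Tendsto (fun i => F i (⌊x i⌋₊ + 1) - F i ⌊x i⌋₊) l (𝓝 0) := by simpa using h1.sub h0
  rw [← add_zero L]
  refine h0.add (squeeze_zero_norm' ?_ (by simpa using hd.norm))
  filter_upwards [hx] with i hi
  rw [norm_mul]
  refine mul_le_of_le_one_left (norm_nonneg _) ?_
  rw [Real.norm_eq_abs, abs_le]
  constructor <;> linarith [Nat.floor_le hi, Nat.lt_floor_add_one (x i)]

theorem tendstoUniformlyOn_of_tendsto_prod {X Y ι : Type*} [TopologicalSpace X]
    [PseudoMetricSpace Y] {l : Filter ι} [l.NeBot] {F : ι → X → Y} {f : X → Y} {K : Set X}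
    (hK : IsCompact K)
    (h : ∀ x ∈ K, Tendsto (fun p : ι × X => F p.1 p.2) (l ×ˢ 𝓝[K] x) (𝓝 (f x))) :
    TendstoUniformlyOn F f l K := by
  rw [← tendstoLocallyUniformlyOn_iff_tendstoUniformlyOn_of_compact hK,
    Metric.tendstoLocallyUniformlyOn_iff]
  intro ε hε x hx
  have h1 := (Metric.tendsto_nhds.1 (h x hx)) (ε / 2) (half_pos hε)
  obtain ⟨p, hp, q, hq, hpq⟩ := eventually_prod_iff.1 h1
  refine ⟨{y | q y} ∩ K, inter_mem hq self_mem_nhdsWithin, ?_⟩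
  filter_upwards [hp] with n hn y hy
  have hy1 : Tendsto (fun i => F i y) l (𝓝 (f y)) :=
    (h y hy.2).comp (tendsto_id.prodMk (tendsto_const_pure.mono_right (pure_le_nhdsWithin hy.2)))
  have hy2 : dist (f y) (f x) ≤ ε / 2 :=
    le_of_tendsto (hy1.dist tendsto_const_nhds) (hp.mono fun i hi => (hpq hi hy.1).le)
  calc dist (f y) (F n y) ≤ dist (f y) (f x) + dist (F n y) (f x) := dist_triangle_right _ _ _
    _ < ε := by linarith [hpq hn hy.1]

/-- If `w(n) M(n) n^{1-ν} → 1` with `M` slowly varying, and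
`δ_N = δ̂ M(N) N^{-ν}`, then the linearly interpolated free partition functions
`Ψ_{δ_N}(Nt)` converge to `Ψ̂^{ν}_{δ̂}(t)` uniformly on `[0,T]`; moreover
`Ψ̂^{ν}_{δ̂}(t)` is finite for every `t ≥ 0`. -/
theorem stmt_5 (ν : ℝ) (hν : ν ∈ Set.Ioo (0:ℝ) 1)
    (M : ℝ → ℝ) (hM_pos : ∀ x : ℝ, 0 < x → 0 < M x) (hM_meas : Measurable M)
    (hM_slow : ∀ c : ℝ, 0 < c →
      Filter.Tendsto (fun x : ℝ => M (c * x) / M x) Filter.atTop (nhds 1))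
    (w : ℕ → ℝ) (hw_pos : ∀ n, 0 < w n)
    (hw_asymp : Filter.Tendsto (fun n : ℕ => w n * M n * (n : ℝ) ^ (1 - ν))
      Filter.atTop (nhds 1))
    (dh : ℝ) (δ : ℕ → ℝ) (hδ : ∀ N : ℕ, δ N = dh * M N / (N : ℝ) ^ ν) :
    (∀ T : ℝ, 0 < T →
      TendstoUniformlyOn (fun (N : ℕ) (t : ℝ) => interp (PsiFree w (δ N)) ((N : ℝ) * t))
        (fun t => PsiHatFree ν dh t) Filter.atTop (Set.Icc 0 T))
    ∧ (∀ t : ℝ, 0 ≤ t →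
        (∀ k : ℕ, simplexIntLFree ν t k ≠ ⊤)
        ∧ Summable (fun k : ℕ => dh ^ (k + 1) * simplexIntFree ν t k)) := by
  set a : ℕ → ℝ := fun N => M N / (N : ℝ) ^ ν
  have ha : ∀ N, 0 ≤ a N := fun N => by
    rcases N.eq_zero_or_pos with rfl | hN
    · simp [a, Real.zero_rpow hν.1.ne']
    · have := hM_pos N (by exact_mod_cast hN)
      positivity
  have hw : ∀ n, 0 ≤ w n := fun n => (hw_pos n).le
  have hα : 0 < ν / 2 := half_pos hν.1
  have hα1 : ν / 2 ≤ 1 := by linarith [hν.2]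
  have hdom := fun (K : ℝ) (hK : 1 ≤ K) =>
    exists_scale_mul_weight_le hν hM_pos hM_meas hM_slow hw_pos hw_asymp hK
  have hsum : ∀ t, 0 ≤ t → Summable fun k => dh ^ k * simplexIntOfNat ν k t := fun t ht =>
    summable_pow_mul_simplexIntOfNat (a := a) hν.1 hw ha hα hα1 hdom (fun n x hx hn =>
      tendsto_scale_mul_weight hM_pos hM_meas hM_slow hw_asymp tendsto_id hx hn) dh ht
  refine ⟨fun T _ => tendstoUniformlyOn_of_tendsto_prod isCompact_Icc fun t ht => ?_, fun t ht =>
    ⟨fun k => simplexIntLFree_ne_top hν.1 k t, (summable_nat_add_iff 1).2 (hsum t ht)⟩⟩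
  have hPsi : PsiHatFree ν dh t = ∑' k, dh ^ k * simplexIntOfNat ν k t := by
    rw [(hsum t ht.1).tsum_eq_zero_add]
    simp [PsiHatFree, simplexIntOfNat]
  have hN : Tendsto (fun p : ℕ × ℝ => p.1) (atTop ×ˢ 𝓝[Set.Icc 0 T] t) atTop := tendsto_fst
  have hs : Tendsto (fun p : ℕ × ℝ => p.2) (atTop ×ˢ 𝓝[Set.Icc 0 T] t) (𝓝 t) :=
    tendsto_snd.mono_right nhdsWithin_le_nhds
  have hs0 : ∀ᶠ p : ℕ × ℝ in atTop ×ˢ 𝓝[Set.Icc 0 T] t, 0 ≤ p.2 :=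
    (tendsto_snd.eventually self_mem_nhdsWithin).mono fun p hp => hp.1
  have hfloor := tendsto_natFloor_div hN hs0 hs
  have hfloor1 : Tendsto (fun p : ℕ × ℝ => ((⌊(p.1 : ℝ) * p.2⌋₊ + 1 : ℕ) : ℝ) / p.1)
      (atTop ×ˢ 𝓝[Set.Icc 0 T] t) (𝓝 t) := by
    simpa [add_div] using hfloor.add
      (tendsto_inv_atTop_zero.comp (tendsto_natCast_atTop_atTop.comp hN))
  have hδa : ∀ N, δ N = dh * a N := fun N => by rw [hδ, mul_div_assoc]
  have key := fun (m : ℕ × ℝ → ℕ) => tendsto_psiFree (a := a) (m := m) hν.1 hw ha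
    (tendsto_scale_zero hν.1 hM_pos hM_meas hM_slow) hα hα1 hdom hN (fun n x hx hn =>
      tendsto_scale_mul_weight hM_pos hM_meas hM_slow hw_asymp hN hx hn) dh ht.1
  rw [hPsi]
  simp only [hδa]
  refine tendsto_interp ?_ (key _ hfloor) (key _ hfloor1)
  exact hs0.mono fun p hp => by positivity
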